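/- arXiv:1403.5852 — 6 statements merged into one kernel-verified Lean document; each statement's English description precedes it below -/
import Mathlib

section
/- Let R be a Poisson algebra over a field k and let α, δ : R → R be k-linear maps. Then there exists a Poisson bracket on the polynomial algebra R[x] extending the Poisson bracket of R (i.e. whose restriction to constant polynomials coincides with the bracket of R) and satisfying {x, r} = α(r)·x + δ(r) for all r ∈ R, if and only if α is a Poisson derivation of R and δ is a Poisson α-derivation of R. -/
/-- A Poisson bracket on a commutative `k`-algebra `R`: a `k`-bilinear map that is
antisymmetric, satisfies the Jacobi identity and the Leibniz rule. -/
structure PoissonBracket (k R : Type*) [Field k] [CommRing R] [Algebra k R] where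
  br : R →ₗ[k] R →ₗ[k] R
  antisymm : ∀ r s : R, br r s = - br s r
  jacobi : ∀ r s t : R, br r (br s t) + br s (br t r) + br t (br r s) = 0
  leibniz : ∀ r s t : R, br (r * s) t = r * br s t + br r t * s

open Polynomial in
/-- A property of polynomials that holds for constants and for `X` and is stable under
sums and products holds for all polynomials. -/
theorem Polynomial.induction_generators {R : Type*} [CommRing R] {p : R[X] → Prop}
    (hC : ∀ a, p (C a)) (hX : p X) (hadd : ∀ f g, p f → p g → p (f + g))
    (hmul : ∀ f g, p f → p g → p (f * g)) (f : R[X]) : p f := by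
  induction f using Polynomial.induction_on with
  | C a => exact hC a
  | add f g hf hg => exact hadd f g hf hg
  | monomial n a h => rw [pow_succ, ← mul_assoc]; exact hmul _ _ h hX

namespace PoissonOre

open Polynomial

variable {k R : Type*} [Field k] [CommRing R] [Algebra k R]

/-- The `X`-linear extension to `R[X]` of a `k`-linear map from `R` to an `R[X]`-module. -/
noncomputable def extend {M : Type*} [AddCommGroup M] [Module k M] [Module R[X] M]
    [SMulCommClass R[X] k M] (φ : R →ₗ[k] M) : R[X] →ₗ[k] M :=
  lsum fun n => DistribSMul.toLinearMap k M (X ^ n : R[X]) ∘ₗ φ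

theorem extend_monomial {M : Type*} [AddCommGroup M] [Module k M] [Module R[X] M]
    [SMulCommClass R[X] k M] (φ : R →ₗ[k] M) (n : ℕ) (r : R) :
    extend φ (monomial n r) = (X ^ n : R[X]) • φ r := by
  simp [extend, lsum_apply, sum_monomial_index]

theorem extend_C {M : Type*} [AddCommGroup M] [Module k M] [Module R[X] M]
    [SMulCommClass R[X] k M] (φ : R →ₗ[k] M) (r : R) : extend φ (C r) = φ r := by
  simpa using extend_monomial φ 0 r

/-- Constant polynomials, as a `k`-linear map. -/
noncomputable def constLin (k R : Type*) [Field k] [CommRing R] [Algebra k R] : R →ₗ[k] R[X] :=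
  (CAlgHom : R →ₐ[k] R[X]).toLinearMap

@[simp]
theorem constLin_apply (r : R) : constLin k R r = C r := rfl

/-- The map `r ↦ α(r) X + δ(r)`, extended to `R[X]` so as to kill `X`. -/
noncomputable def oreMap (α δ : R →ₗ[k] R) : R[X] →ₗ[k] R[X] :=
  extend (LinearMap.mulRight k X ∘ₗ constLin k R ∘ₗ α + constLin k R ∘ₗ δ)

theorem oreMap_monomial (α δ : R →ₗ[k] R) (n : ℕ) (r : R) :
    oreMap α δ (monomial n r) = X ^ n * (C (α r) * X + C (δ r)) := by
  simp [oreMap, extend_monomial]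

theorem oreMap_C (α δ : R →ₗ[k] R) (r : R) :
    oreMap α δ (C r) = C (α r) * X + C (δ r) := by
  simp [oreMap, extend_C]

theorem oreMap_mul {α δ : R →ₗ[k] R} (hα : ∀ r s : R, α (r * s) = α r * s + r * α s)
    (hδ : ∀ r s : R, δ (r * s) = δ r * s + r * δ s) (f g : R[X]) :
    oreMap α δ (f * g) = f * oreMap α δ g + oreMap α δ f * g := by
  induction f using Polynomial.induction_on' with
  | add f f' hf hf' => simp only [add_mul, map_add, hf, hf']; ring
  | monomial n r =>
    induction g using Polynomial.induction_on' with
    | add g g' hg hg' => simp only [mul_add, map_add, hg, hg']; ring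
    | monomial m s =>
      rw [monomial_mul_monomial]
      simp only [oreMap_monomial, hα, hδ]
      simp only [C_add, C_mul, ← C_mul_X_pow_eq_monomial, pow_add]
      ring

/-- The coefficientwise extension to `R[X]` of a bilinear map on `R`. -/
noncomputable def coeffBr (β : R →ₗ[k] R →ₗ[k] R) : R[X] →ₗ[k] R[X] →ₗ[k] R[X] :=
  extend (M := R[X] →ₗ[k] R[X])
    { toFun := fun r => extend (constLin k R ∘ₗ β r)
      map_add' := fun r s => by
        refine LinearMap.ext fun f => ?_
        induction f using Polynomial.induction_on' with
        | add f g hf hg => rw [map_add _ f g, map_add _ f g, hf, hg]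
        | monomial n t => simp [extend_monomial, mul_add]
      map_smul' := fun c r => by
        refine LinearMap.ext fun f => ?_
        induction f using Polynomial.induction_on' with
        | add f g hf hg => rw [map_add _ f g, map_add _ f g, hf, hg]
        | monomial n t => simp [extend_monomial, -smul_C] }

theorem coeffBr_monomial (β : R →ₗ[k] R →ₗ[k] R) (n m : ℕ) (r s : R) :
    coeffBr β (monomial n r) (monomial m s) = X ^ n * (X ^ m * C (β r s)) := by
  simp [coeffBr, extend_monomial]

theorem coeffBr_antisymm {β : R →ₗ[k] R →ₗ[k] R} (hβ : ∀ r s, β r s = -β s r) (f g : R[X]) :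
    coeffBr β f g = -coeffBr β g f := by
  induction f using Polynomial.induction_on' with
  | add f f' hf hf' => simp only [map_add, LinearMap.add_apply, hf, hf']; ring
  | monomial n r =>
    induction g using Polynomial.induction_on' with
    | add g g' hg hg' => simp only [map_add, LinearMap.add_apply, hg, hg']; ring
    | monomial m s =>
      rw [coeffBr_monomial, coeffBr_monomial, hβ, C_neg]
      ring

theorem coeffBr_mul {β : R →ₗ[k] R →ₗ[k] R}
    (hβ : ∀ r s t, β (r * s) t = r * β s t + β r t * s) (f g h : R[X]) :
    coeffBr β (f * g) h = f * coeffBr β g h + coeffBr β f h * g := by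
  induction f using Polynomial.induction_on' with
  | add f f' hf hf' => simp only [add_mul, map_add, LinearMap.add_apply, hf, hf']; ring
  | monomial n r =>
    induction g using Polynomial.induction_on' with
    | add g g' hg hg' => simp only [mul_add, map_add, LinearMap.add_apply, hg, hg']; ring
    | monomial m s =>
      induction h using Polynomial.induction_on' with
      | add h h' hh hh' => simp only [map_add, hh, hh']; ring
      | monomial l t =>
        rw [monomial_mul_monomial]
        simp only [coeffBr_monomial, hβ]
        simp only [C_add, C_mul, ← C_mul_X_pow_eq_monomial, pow_add]
        ring

/-- The bracket `f, g ↦ {f, g}_R + f' D(g) - D(f) g'`, where `{-,-}_R` acts coefficientwise and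
`D` is `oreMap α δ`. -/
noncomputable def oreBr (β : R →ₗ[k] R →ₗ[k] R) (α δ : R →ₗ[k] R) :
    R[X] →ₗ[k] R[X] →ₗ[k] R[X] :=
  let d : R[X] →ₗ[k] R[X] := (derivative : R[X] →ₗ[R] R[X]).restrictScalars k
  coeffBr β + (LinearMap.mul k R[X]).compl₁₂ d (oreMap α δ)
    - (LinearMap.mul k R[X]).compl₁₂ (oreMap α δ) d

theorem oreBr_apply (β : R →ₗ[k] R →ₗ[k] R) (α δ : R →ₗ[k] R) (f g : R[X]) :
    oreBr β α δ f g =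
      coeffBr β f g + derivative f * oreMap α δ g - oreMap α δ f * derivative g := rfl

theorem oreBr_antisymm {β : R →ₗ[k] R →ₗ[k] R} (α δ : R →ₗ[k] R)
    (hβ : ∀ r s, β r s = -β s r) (f g : R[X]) :
    oreBr β α δ f g = -oreBr β α δ g f := by
  rw [oreBr_apply, oreBr_apply, coeffBr_antisymm hβ]
  ring

theorem oreBr_mul {β : R →ₗ[k] R →ₗ[k] R} {α δ : R →ₗ[k] R}
    (hβ : ∀ r s t, β (r * s) t = r * β s t + β r t * s)
    (hα : ∀ r s : R, α (r * s) = α r * s + r * α s)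
    (hδ : ∀ r s : R, δ (r * s) = δ r * s + r * δ s) (f g h : R[X]) :
    oreBr β α δ (f * g) h = f * oreBr β α δ g h + oreBr β α δ f h * g := by
  simp only [oreBr_apply, coeffBr_mul hβ, oreMap_mul hα hδ, derivative_mul]
  ring

theorem oreBr_C_C (β : R →ₗ[k] R →ₗ[k] R) (α δ : R →ₗ[k] R) (r s : R) :
    oreBr β α δ (C r) (C s) = C (β r s) := by
  simpa [oreBr_apply] using coeffBr_monomial β 0 0 r s

/-- The Jacobiator of a bilinear map. -/
def jacobiator {A : Type*} [CommRing A] [Algebra k A] (b : A →ₗ[k] A →ₗ[k] A) (f g h : A) : A :=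
  b f (b g h) + b g (b h f) + b h (b f g)

section jacobiator

variable {A : Type*} [CommRing A] [Algebra k A] {b : A →ₗ[k] A →ₗ[k] A}

theorem jacobiator_rotate (f g h : A) : jacobiator b f g h = jacobiator b g h f := by
  simp only [jacobiator]
  ring

theorem jacobiator_add (f f' g h : A) :
    jacobiator b (f + f') g h = jacobiator b f g h + jacobiator b f' g h := by
  simp only [jacobiator, map_add, LinearMap.add_apply]
  ring

theorem br_mul_right (hanti : ∀ f g, b f g = -b g f)
    (hmul : ∀ f g h, b (f * g) h = f * b g h + b f h * g) (f g h : A) :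
    b f (g * h) = g * b f h + b f g * h := by
  rw [hanti, hmul, hanti g, hanti h]
  ring

theorem jacobiator_mul (hanti : ∀ f g, b f g = -b g f)
    (hmul : ∀ f g h, b (f * g) h = f * b g h + b f h * g) (f f' g h : A) :
    jacobiator b (f * f') g h = f * jacobiator b f' g h + jacobiator b f g h * f' := by
  simp only [jacobiator, hmul, br_mul_right hanti hmul, map_add]
  rw [hanti f g, hanti f' g, map_neg, map_neg]
  ring

end jacobiator

theorem jacobiator_eq_zero {b : R[X] →ₗ[k] R[X] →ₗ[k] R[X]} (hanti : ∀ f g, b f g = -b g f)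
    (hmul : ∀ f g h, b (f * g) h = f * b g h + b f h * g)
    (hX : b X X = 0) (hCCC : ∀ r s t, jacobiator b (C r) (C s) (C t) = 0)
    (hXCC : ∀ r s, jacobiator b X (C r) (C s) = 0) (f g h : R[X]) :
    jacobiator b f g h = 0 := by
  have hXXC (f : R[X]) : jacobiator b X X f = 0 := by
    simp [jacobiator, hX, hanti f X]
  have key (g h : R[X]) (hC : ∀ r, jacobiator b (C r) g h = 0)
      (hX' : jacobiator b X g h = 0) (f : R[X]) : jacobiator b f g h = 0 := by
    induction f using Polynomial.induction_generators with
    | hC r => exact hC r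
    | hX => exact hX'
    | hadd f f' hf hf' => rw [jacobiator_add, hf, hf', add_zero]
    | hmul f f' hf hf' => rw [jacobiator_mul hanti hmul, hf, hf', mul_zero, zero_mul, add_zero]
  have hCC (r s : R) : ∀ f, jacobiator b f (C r) (C s) = 0 :=
    key _ _ (fun t => hCCC t r s) (hXCC r s)
  have hCX (r : R) : ∀ f, jacobiator b f (C r) X = 0 :=
    key _ _ (fun t => (jacobiator_rotate _ _ _).symm.trans (hXCC t r))
      ((jacobiator_rotate _ _ _).symm.trans (hXXC (C r)))
  have hXC (r : R) : ∀ f, jacobiator b f X (C r) = 0 :=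
    key _ _ (fun t => (jacobiator_rotate _ _ _).trans (hXCC r t)) (hXXC (C r))
  have hC (r : R) (f : R[X]) : ∀ g, jacobiator b g (C r) f = 0 :=
    key _ _ (fun s => (jacobiator_rotate _ _ _).symm.trans (hCC s r f))
      ((jacobiator_rotate _ _ _).symm.trans (hXC r f))
  have hX' (f : R[X]) : ∀ g, jacobiator b g X f = 0 :=
    key _ _ (fun s => (jacobiator_rotate _ _ _).symm.trans (hCX s f)) (hXXC f)
  exact key _ _ (fun r => (jacobiator_rotate _ _ _).symm.trans (hC r g h))
    ((jacobiator_rotate _ _ _).symm.trans (hX' g h)) f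

theorem linear_coeffs_eq {a b c d : R} (h : C a * X + C b = C c * X + C d) :
    a = c ∧ b = d :=
  ⟨by simpa using congrArg (coeff · 1) h, by simpa using congrArg (coeff · 0) h⟩

theorem map_one_eq_zero {φ : R → R} (hφ : ∀ r s, φ (r * s) = φ r * s + r * φ s) : φ 1 = 0 := by
  simpa using hφ 1 1

theorem br_one_left {A : Type*} [CommRing A] [Algebra k A] {b : A →ₗ[k] A →ₗ[k] A}
    (hb : ∀ r s t, b (r * s) t = r * b s t + b r t * s) (t : A) : b 1 t = 0 := by
  simpa using hb 1 1 t

theorem oreMap_X {α δ : R →ₗ[k] R} (hα : ∀ r s : R, α (r * s) = α r * s + r * α s)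
    (hδ : ∀ r s : R, δ (r * s) = δ r * s + r * δ s) : oreMap α δ X = 0 := by
  rw [← monomial_one_one_eq_X, oreMap_monomial, map_one_eq_zero hα, map_one_eq_zero hδ]
  simp

theorem oreBr_X_C {β : R →ₗ[k] R →ₗ[k] R} {α δ : R →ₗ[k] R}
    (hβ : ∀ r s t, β (r * s) t = r * β s t + β r t * s) (r : R) :
    oreBr β α δ X (C r) = C (α r) * X + C (δ r) := by
  have h : coeffBr β X (C r) = 0 := by
    simpa [br_one_left hβ, monomial_one_one_eq_X] using coeffBr_monomial β 1 0 1 r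
  simp [oreBr_apply, h, oreMap_C]

theorem oreBr_X_X {β : R →ₗ[k] R →ₗ[k] R} {α δ : R →ₗ[k] R}
    (hβ : ∀ r s t, β (r * s) t = r * β s t + β r t * s)
    (hα : ∀ r s : R, α (r * s) = α r * s + r * α s)
    (hδ : ∀ r s : R, δ (r * s) = δ r * s + r * δ s) : oreBr β α δ X X = 0 := by
  have h : coeffBr β X X = 0 := by
    simpa [br_one_left hβ, monomial_one_one_eq_X] using coeffBr_monomial β 1 1 1 1
  simp [oreBr_apply, h, oreMap_X hα hδ]

end PoissonOre

open Polynomial in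
/-- There is a Poisson bracket on `R[x]` extending that of `R` with
`{x, r} = α(r)·x + δ(r)` iff `α` is a Poisson derivation and `δ` is a
Poisson `α`-derivation. -/
theorem stmt0 {k R : Type*} [Field k] [CommRing R] [Algebra k R]
    (P : PoissonBracket k R) (α δ : R →ₗ[k] R) :
    (∃ B : PoissonBracket k R[X],
      (∀ r s : R, B.br (Polynomial.C r) (Polynomial.C s) = Polynomial.C (P.br r s)) ∧
      (∀ r : R, B.br Polynomial.X (Polynomial.C r)
        = Polynomial.C (α r) * Polynomial.X + Polynomial.C (δ r))) ↔
    ((∀ r s : R, α (r * s) = α r * s + r * α s) ∧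
     (∀ r s : R, α (P.br r s) = P.br (α r) s + P.br r (α s)) ∧
     (∀ r s : R, δ (r * s) = δ r * s + r * δ s) ∧
     (∀ r s : R, δ (P.br r s) = P.br (δ r) s + P.br r (δ s) + α r * δ s - δ r * α s)) := by
  constructor
  · rintro ⟨B, hCC, hXC⟩
    have hCX (r : R) : B.br (C r) X = -(C (α r) * X + C (δ r)) := by rw [B.antisymm, hXC]
    have hmul (r s : R) : α (r * s) = α r * s + r * α s ∧ δ (r * s) = δ r * s + r * δ s := by
      apply PoissonOre.linear_coeffs_eq
      rw [← hXC, C_mul, PoissonOre.br_mul_right B.antisymm B.leibniz, hXC, hXC]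
      simp only [C_add, C_mul]
      ring
    have hbr (r s : R) : α (P.br r s) = P.br (α r) s + P.br r (α s) ∧
        δ (P.br r s) = P.br (δ r) s + P.br r (δ s) + α r * δ s - δ r * α s := by
      apply PoissonOre.linear_coeffs_eq
      have h := B.jacobi X (C r) (C s)
      rw [hCC, hXC, hCX, hXC, map_neg, map_add, map_add,
        PoissonOre.br_mul_right B.antisymm B.leibniz, PoissonOre.br_mul_right B.antisymm B.leibniz,
        hCX, hCX, hCC, hCC, hCC, hCC, P.antisymm s, P.antisymm s] at h
      simp only [C_add, C_sub, C_mul, C_neg] at h ⊢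
      linear_combination h
    exact ⟨fun r s => (hmul r s).1, fun r s => (hbr r s).1, fun r s => (hmul r s).2,
      fun r s => (hbr r s).2⟩
  · rintro ⟨hα, hα', hδ, hδ'⟩
    have hanti := PoissonOre.oreBr_antisymm α δ P.antisymm
    have hmul := PoissonOre.oreBr_mul P.leibniz hα hδ
    have hXC := PoissonOre.oreBr_X_C (α := α) (δ := δ) P.leibniz
    have hCC := PoissonOre.oreBr_C_C P.br α δ
    refine ⟨⟨PoissonOre.oreBr P.br α δ, hanti, ?_, hmul⟩, hCC, hXC⟩
    refine PoissonOre.jacobiator_eq_zero hanti hmul ?_ (fun r s t => ?_) fun r s => ?_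
    · exact PoissonOre.oreBr_X_X P.leibniz hα hδ
    · simp only [PoissonOre.jacobiator, hCC, ← C_add, P.jacobi, C_0]
    · rw [PoissonOre.jacobiator, hCC, hXC, hanti (C s) X, hXC, hXC, map_neg, map_add, map_add,
        PoissonOre.br_mul_right hanti hmul, PoissonOre.br_mul_right hanti hmul,
        hanti (C r) X, hanti (C s) X, hXC, hXC, hCC, hCC, hCC, hCC, P.antisymm s,
        P.antisymm s, hα', hδ']
      simp only [C_add, C_sub, C_mul, C_neg]
      ring
end

section
/- Let R be a Poisson algebra over a field k, let α be a Poisson derivation of R, and let (A, m, h) be a triple with property P. Define maps f, g : R → M₂(A) by f(r) = [[m(r), 0], [m(α(r)), m(r)]] and g(r) = [[h(r) + m(α(r)), 0], [h(α(r)) + m(α(α(r))), h(r) + m(α(r))]]. Then the triple (M₂(A), f, g) has property P; that is, f is a k-algebra homomorphism, g is k-linear, and for all r, s ∈ R: g({r,s}) = g(r)g(s) − g(s)g(r), f({r,s}) = g(r)f(s) − f(s)g(r), and g(rs) = f(r)g(s) + f(s)g(r). -/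
/-- If `(A, m, h)` has property **P** and `α` is a Poisson derivation of `R`, then
the triple `(M₂(A), f, g)` defined by (2.3) has property **P**. -/
theorem stmt2 {k R A : Type*} [Field k] [CommRing R] [Algebra k R] [Ring A] [Algebra k A]
    (P : PoissonBracket k R) (α : R →ₗ[k] R)
    (hα1 : ∀ r s : R, α (r * s) = α r * s + r * α s)
    (hα2 : ∀ r s : R, α (P.br r s) = P.br (α r) s + P.br r (α s))
    (m : R →ₐ[k] A) (h : R →ₗ[k] A)
    (hP1 : ∀ r s : R, h (P.br r s) = h r * h s - h s * h r)
    (hP2 : ∀ r s : R, m (P.br r s) = h r * m s - m s * h r)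
    (hP3 : ∀ r s : R, h (r * s) = m r * h s + m s * h r)
    (f g : R → Matrix (Fin 2) (Fin 2) A)
    (hf : ∀ r : R, f r = !![m r, 0; m (α r), m r])
    (hg : ∀ r : R, g r = !![h r + m (α r), 0; h (α r) + m (α (α r)), h r + m (α r)]) :
    -- `f` is a `k`-algebra homomorphism
    (f 1 = 1) ∧ (∀ r s : R, f (r * s) = f r * f s) ∧ (∀ r s : R, f (r + s) = f r + f s) ∧
    (∀ (c : k) (r : R), f (c • r) = c • f r) ∧
    -- `g` is `k`-linear
    (∀ r s : R, g (r + s) = g r + g s) ∧ (∀ (c : k) (r : R), g (c • r) = c • g r) ∧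
    -- property **P**
    (∀ r s : R, g (P.br r s) = g r * g s - g s * g r) ∧
    (∀ r s : R, f (P.br r s) = g r * f s - f s * g r) ∧
    (∀ r s : R, g (r * s) = f r * g s + f s * g r) := by
  have comm : ∀ r s : R, m r * m s = m s * m r := fun r s => by
    rw [← map_mul, ← map_mul, mul_comm]
  have hP2' : ∀ r s : R, m (P.br r s) = m r * h s - h s * m r := fun r s => by
    rw [P.antisymm, map_neg, hP2, neg_sub]
  have hα0 : α 1 = 0 := by simpa using hα1 1 1
  refine ⟨?_, fun r s => ?_, fun r s => ?_, fun c r => ?_, fun r s => ?_, fun c r => ?_,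
    fun r s => ?_, fun r s => ?_, fun r s => ?_⟩
  · rw [hf, hα0, map_one, map_zero, Matrix.one_fin_two]
  · simp only [hf, hα1, map_add, map_mul]
    ext i j; fin_cases i <;> fin_cases j <;> simp
  · simp only [hf, map_add]
    ext i j; fin_cases i <;> fin_cases j <;> simp
  · simp only [hf, map_smul]
    ext i j; fin_cases i <;> fin_cases j <;> simp
  · simp only [hg, map_add]
    ext i j; fin_cases i <;> fin_cases j <;> simp <;> abel
  · simp only [hg, map_smul]
    ext i j; fin_cases i <;> fin_cases j <;> simp
  · have diag : h (P.br r s) + m (α (P.br r s)) =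
        (h r + m (α r)) * (h s + m (α s)) - (h s + m (α s)) * (h r + m (α r)) := by
      rw [hα2, map_add, hP1, hP2' (α r), hP2 r]
      simp only [mul_add, add_mul, comm (α s) (α r)]
      abel
    have offDiag : h (α (P.br r s)) + m (α (α (P.br r s))) =
        ((h (α r) + m (α (α r))) * (h s + m (α s)) + (h r + m (α r)) * (h (α s) + m (α (α s)))) -
        ((h (α s) + m (α (α s))) * (h r + m (α r)) +
          (h s + m (α s)) * (h (α r) + m (α (α r)))) := by
      simp only [hα2, map_add]
      rw [hP1, hP1, hP2' (α (α r)), hP2 r]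
      nth_rw 1 [hP2 (α r)]
      rw [hP2' (α r)]
      simp only [mul_add, add_mul, comm (α s) (α (α r)), comm (α (α s)) (α r)]
      abel
    simp only [hg]
    rw [diag, offDiag]
    ext i j; fin_cases i <;> fin_cases j <;> simp
  · simp only [hf, hg, hα2, map_add, hP2]
    ext i j; fin_cases i <;> fin_cases j <;>
      simp [mul_add, add_mul, comm (α r) s, comm (α (α r)) s, comm (α r) (α s)] <;> abel
  · simp only [hf, hg, hα1, map_add, map_mul, hP3]
    ext i j; fin_cases i <;> fin_cases j <;>
      simp [mul_add, comm (α r) s, comm (α (α r)) s, comm (α s) (α r)] <;> abel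
end

section
/- Let k be a field and let C = (c_{ij}) ∈ M_n(k) be an alternating matrix, i.e. Cᵀ = −C and every diagonal entry of C is zero. Then c_{ij}c_{ks} + c_{jk}c_{is} + c_{ki}c_{js} = 0 for all indices 1 ≤ i < j < k < s ≤ n if and only if rank(C) ≤ 2. -/
open Matrix

/-- The Pfaffian relations on increasing quadruples of an alternating family extend to all
quadruples. -/
theorem pfaffian_relation_of_lt {ι R : Type*} [LinearOrder ι] [CommRing R] (C : ι → ι → R)
    (hC : ∀ i j, C j i = -C i j) (hdiag : ∀ i, C i i = 0)
    (h : ∀ i j l s, i < j → j < l → l < s →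
      C i j * C l s + C j l * C i s + C l i * C j s = 0) (i j l s : ι) :
    C i j * C l s + C j l * C i s + C l i * C j s = 0 := by
  have swap₁ : ∀ i j l s, C i j * C l s + C j l * C i s + C l i * C j s = 0 →
      C j i * C l s + C i l * C j s + C l j * C i s = 0 := fun i j l s h ↦ by
    rw [hC i j, hC l i, hC j l]; linear_combination -h
  have swap₂ : ∀ i j l s, C i j * C l s + C j l * C i s + C l i * C j s = 0 →
      C i l * C j s + C l j * C i s + C j i * C l s = 0 := fun i j l s h ↦ by
    rw [hC i j, hC l i, hC j l]; linear_combination -h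
  have swap₃ : ∀ i j l s, C i j * C l s + C j l * C i s + C l i * C j s = 0 →
      C i j * C s l + C j s * C i l + C s i * C j l = 0 := fun i j l s h ↦ by
    rw [hC l s, hC i s, hC l i]; linear_combination -h
  have eq₁ : ∀ i l s, C i i * C l s + C i l * C i s + C l i * C i s = 0 := fun i l s ↦ by
    rw [hC i l, hdiag]; ring
  have eq₂ : ∀ i j s, C i j * C j s + C j j * C i s + C j i * C j s = 0 := fun i j s ↦ by
    rw [hC i j, hdiag]; ring
  have eq₃ : ∀ i j l, C i j * C l l + C j l * C i l + C l i * C j l = 0 := fun i j l ↦ by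
    rw [hC i l, hdiag]; ring
  have three : ∀ i j l s, i < j → j < l →
      C i j * C l s + C j l * C i s + C l i * C j s = 0 := by
    intro i j l s hij hjl
    rcases lt_trichotomy l s with hls | rfl | hls
    · exact h i j l s hij hjl hls
    · exact eq₃ i j l
    refine swap₃ i j s l ?_
    rcases lt_trichotomy j s with hjs | rfl | hjs
    · exact h i j s l hij hjs hls
    · exact eq₂ i j l
    refine swap₂ i s j l ?_
    rcases lt_trichotomy i s with his | rfl | his
    · exact h i s j l his hjs hjl
    · exact eq₁ i j l
    exact swap₁ s i j l (h s i j l his hij hjl)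
  have two : ∀ i j l s, i < j →
      C i j * C l s + C j l * C i s + C l i * C j s = 0 := by
    intro i j l s hij
    rcases lt_trichotomy j l with hjl | rfl | hjl
    · exact three i j l s hij hjl
    · exact eq₂ i j s
    refine swap₂ i l j s ?_
    rcases lt_trichotomy i l with hil | rfl | hil
    · exact three i l j s hil hjl
    · exact eq₁ i j s
    exact swap₁ l i j s (three l i j s hil hij)
  rcases lt_trichotomy i j with hij | rfl | hij
  · exact two i j l s hij
  · exact eq₁ i l s
  · exact swap₁ j i l s (two j i l s hij)

/-- The determinant of a `4 × 4` alternating matrix is the square of its Pfaffian. -/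
theorem det_fin_four_eq_pfaffian_sq {R : Type*} [CommRing R] (A : Matrix (Fin 4) (Fin 4) R)
    (hA : ∀ i j, A j i = -A i j) (hdiag : ∀ i, A i i = 0) :
    A.det = (A 0 1 * A 2 3 + A 1 2 * A 0 3 + A 2 0 * A 1 3) ^ 2 := by
  rw [det_succ_row_zero]
  simp only [det_fin_three, Fin.sum_univ_four, submatrix_apply, Fin.succAbove, Fin.reduceSucc,
    Fin.reduceCastSucc, Fin.reduceLT, if_true, if_false, hdiag, Fin.isValue]
  simp [hA 0 1, hA 0 2, hA 0 3, hA 1 2, hA 1 3, hA 2 3]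
  ring

/-- For an alternating matrix `C`, the Plücker-type relations
`c_{ij}c_{ks} + c_{jk}c_{is} + c_{ki}c_{js} = 0` for all `i < j < k < s` hold iff
`rank C ≤ 2`. -/
theorem stmt5 {k : Type*} [Field k] {n : ℕ} (C : Matrix (Fin n) (Fin n) k)
    (hC : Cᵀ = -C) (hdiag : ∀ i, C i i = 0) :
    (∀ i j l s : Fin n, i < j → j < l → l < s →
      C i j * C l s + C j l * C i s + C l i * C j s = 0) ↔ C.rank ≤ 2 := by
  have hC' : ∀ i j, C j i = -C i j := fun i j ↦ congrFun (congrFun hC i) j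
  constructor
  · intro h
    by_cases h0 : C = 0
    · simp [h0]
    obtain ⟨i, j, hij⟩ : ∃ i j, C i j ≠ 0 := by
      by_contra! hzero
      exact h0 (Matrix.ext hzero)
    have hfac : C = (Matrix.of fun l ↦ ![-(C i j)⁻¹ * C j l, -(C i j)⁻¹ * C l i]) *
        Matrix.of ![C i, C j] := by
      ext l s
      have := pfaffian_relation_of_lt C hC' hdiag h i j l s
      simp only [mul_apply, Fin.sum_univ_two, of_apply, cons_val_zero, cons_val_one]
      field_simp
      linear_combination this
    rw [hfac]
    exact (rank_mul_le_left _ _).trans (rank_le_width _)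
  · intro h i j l s _ _ _
    by_contra hne
    let v : Fin 4 → Fin n := ![i, j, l, s]
    have hdet : (C.submatrix v v).det ≠ 0 := by
      rw [det_fin_four_eq_pfaffian_sq (C.submatrix v v) (fun _ _ ↦ hC' _ _) (fun _ ↦ hdiag _)]
      exact pow_ne_zero 2 hne
    have hrank := rank_of_det_ne_zero hdet
    have hle := rank_submatrix_le C v v
    rw [hrank, Fintype.card_fin] at hle
    omega
end

section
/- Let k be a field of characteristic different from 2, n a positive integer, and C = (c_{ij}) ∈ M_n(k) a skew-symmetric matrix (Cᵀ = −C). Then there exists a Poisson bracket {-,-} on the polynomial algebra k[x_1, …, x_n] satisfying {x_i, x_j} = c_{ij}·(x_1² + x_2² + ⋯ + x_n²) for all 1 ≤ i, j ≤ n if and only if rank(C) ≤ 2. -/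
open Matrix

/-- For commuting derivations `D` and `E` and any `f`, the bracket `f (D r E s - E r D s)` is
Poisson. -/
def PoissonBracket.ofCommute {k R : Type*} [Field k] [CommRing R] [Algebra k R]
    (D E : Derivation k R R) (f : R) (h : ∀ r, D (E r) = E (D r)) : PoissonBracket k R where
  br := LinearMap.mk₂ k (fun r s => f * (D r * E s - E r * D s))
    (fun _ _ _ => by simp only [map_add]; ring)
    (fun _ _ _ => by simp only [Derivation.map_smul]; simp only [Algebra.smul_def]; ring)
    (fun _ _ _ => by simp only [map_add]; ring)
    (fun _ _ _ => by simp only [Derivation.map_smul]; simp only [Algebra.smul_def]; ring)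
  antisymm r s := by simp only [LinearMap.mk₂_apply]; ring
  jacobi r s t := by
    simp only [LinearMap.mk₂_apply, Derivation.leibniz, map_sub, smul_eq_mul, h]
    ring
  leibniz r s t := by
    simp only [LinearMap.mk₂_apply, Derivation.leibniz, smul_eq_mul]
    ring

lemma Matrix.apply_eq_neg_of_transpose_eq_neg {n k : Type*} [Field k] {A : Matrix n n k}
    (hA : Aᵀ = -A) (i j : n) : A i j = -A j i := by
  simpa using congrFun (congrFun hA j) i

lemma Matrix.diag_eq_zero_of_transpose_eq_neg {n k : Type*} [Field k] (h2 : (2 : k) ≠ 0)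
    {A : Matrix n n k} (hA : Aᵀ = -A) (i : n) : A i i = 0 := by
  have h := apply_eq_neg_of_transpose_eq_neg hA i i
  have h' : 2 * A i i = 0 := by linear_combination h
  exact (mul_eq_zero.mp h').resolve_left h2

/-- The `4 × 4` sub-Pfaffians of a skew-symmetric matrix of rank at most `2` vanish. -/
lemma Matrix.plucker_of_rank_le_two {n k : Type*} [Fintype n] [Field k] (h2 : (2 : k) ≠ 0)
    {A : Matrix n n k} (hA : Aᵀ = -A) (hr : A.rank ≤ 2) (i j l s : n) :
    A j l * A i s + A l i * A j s + A i j * A l s = 0 := by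
  have hdet : (A.submatrix ![i, j, l, s] ![i, j, l, s]).det = 0 := by
    by_contra hne
    have hu : IsUnit (A.submatrix ![i, j, l, s] ![i, j, l, s]) :=
      (Matrix.isUnit_iff_isUnit_det _).mpr (isUnit_iff_ne_zero.mpr hne)
    have h4 := Matrix.rank_of_isUnit _ hu
    have hle := Matrix.rank_submatrix_le A ![i, j, l, s] ![i, j, l, s]
    simp only [Fintype.card_fin] at h4
    omega
  have hd := diag_eq_zero_of_transpose_eq_neg h2 hA
  have hs := apply_eq_neg_of_transpose_eq_neg hA
  have hsq : (A j l * A i s + A l i * A j s + A i j * A l s) ^ 2 = 0 := by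
    have hM : A.submatrix ![i, j, l, s] ![i, j, l, s] =
        !![0, A i j, -A l i, A i s; -A i j, 0, A j l, A j s;
          A l i, -A j l, 0, A l s; -A i s, -A j s, -A l s, 0] := by
      ext p q
      fin_cases p <;> fin_cases q <;> first | exact hd _ | exact hs _ _ | rfl
    rw [← hdet, hM]
    simp [Matrix.det_succ_row_zero, Fin.sum_univ_succ, Fin.succAbove]
    ring
  exact pow_eq_zero_iff (two_ne_zero) |>.mp hsq

lemma Matrix.exists_eq_of_plucker {n k : Type*} [Field k]
    {A : Matrix n n k} (hA : Aᵀ = -A)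
    (h : ∀ i j l s, A j l * A i s + A l i * A j s + A i j * A l s = 0) :
    ∃ (c : k) (u v : n → k), ∀ i j, A i j = c * (u i * v j - v i * u j) := by
  by_cases h0 : ∃ a b, A a b ≠ 0
  · obtain ⟨a, b, hab⟩ := h0
    refine ⟨(A a b)⁻¹, A a, A b, fun i j => ?_⟩
    rw [eq_inv_mul_iff_mul_eq₀ hab]
    have hs := apply_eq_neg_of_transpose_eq_neg hA
    linear_combination h i a b j - A b j * hs i a
  · push Not at h0
    exact ⟨0, 0, 0, fun i j => by simp [h0]⟩

lemma Matrix.rank_le_two_of_eq {n k : Type*} [Fintype n] [Field k]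
    {A : Matrix n n k} {c : k} {u v : n → k}
    (h : ∀ i j, A i j = c * (u i * v j - v i * u j)) : A.rank ≤ 2 := by
  have hA : A = (of fun i => ![u i, v i]) * of ![fun j => c * v j, fun j => -(c * u j)] := by
    ext i j
    simp only [h, mul_apply, Fin.sum_univ_two, of_apply, cons_val_zero, cons_val_one]
    ring
  rw [hA]
  refine (rank_mul_le_left _ _).trans ?_
  simpa using rank_le_card_width (of fun i => ![u i, v i])

namespace MvPolynomial

/-- Derivations with constant coefficients commute. -/
lemma mkDerivation_C_commute {σ k : Type*} [Field k] (u v : σ → k) (p : MvPolynomial σ k) :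
    mkDerivation k (fun i => (C (u i) : MvPolynomial σ k))
        (mkDerivation k (fun i => (C (v i) : MvPolynomial σ k)) p) =
      mkDerivation k (fun i => (C (v i) : MvPolynomial σ k))
        (mkDerivation k (fun i => (C (u i) : MvPolynomial σ k)) p) := by
  set D := mkDerivation k (fun i => (C (u i) : MvPolynomial σ k)) with hD
  set E := mkDerivation k (fun i => (C (v i) : MvPolynomial σ k)) with hE
  have h : ⁅D, E⁆ = 0 := by
    refine derivation_ext fun i => ?_
    simp [Derivation.commutator_apply, hD, hE, mkDerivation_X]
  have hp := congrArg (fun F => F p) h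
  simpa [Derivation.commutator_apply, sub_eq_zero] using hp

/-- The Jacobi identity on generators forces the `4 × 4` sub-Pfaffians to vanish. -/
lemma plucker_of_poissonBracket {k : Type*} [Field k] (h2 : (2 : k) ≠ 0) {n : Type*} [Fintype n]
    {A : Matrix n n k} (hA : Aᵀ = -A) (B : PoissonBracket k (MvPolynomial n k))
    (hB : ∀ i j, B.br (X i) (X j) = C (A i j) * ∑ s, (X s) ^ 2) (i j l s : n) :
    A j l * A i s + A l i * A j s + A i j * A l s = 0 := by
  classical
  set f : MvPolynomial n k := ∑ s, (X s) ^ 2 with hf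
  have hf0 : f ≠ 0 := by
    intro h0
    have h := congrArg (eval (Pi.single i 1)) h0
    simp [hf, Pi.single_apply] at h
  have hbr : ∀ i, B.br (X i) f = f * (2 * ∑ s, C (A i s) * X s) := by
    intro i
    rw [B.antisymm, hf, map_sum, LinearMap.sum_apply, ← hf, Finset.mul_sum, Finset.mul_sum,
      ← Finset.sum_neg_distrib]
    refine Finset.sum_congr rfl fun s _ => ?_
    rw [pow_two, B.leibniz, hB, apply_eq_neg_of_transpose_eq_neg hA s i, C_neg]
    ring
  have hbr' : ∀ i j l, B.br (X i) (B.br (X j) (X l)) =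
      f * (C (A j l) * (2 * ∑ s, C (A i s) * X s)) := by
    intro i j l
    rw [hB, ← smul_eq_C_mul, map_smul, hbr, smul_eq_C_mul]
    ring
  have hj := B.jacobi (X i) (X j) (X l)
  rw [hbr', hbr', hbr', ← mul_add, ← mul_add] at hj
  have h := congrArg (eval (Pi.single s 1)) ((mul_eq_zero.mp hj).resolve_left hf0)
  simp [Pi.single_apply] at h
  exact (mul_eq_zero.mp (by linear_combination h)).resolve_left h2

end MvPolynomial

open MvPolynomial in
/-- Lemma 3.2, (1) ⇔ (4): the bracket `{x_i, x_j} = c_{ij}(x_1² + ⋯ + x_n²)` defines a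
Poisson structure on `k[x_1, …, x_n]` iff the skew-symmetric matrix `C` has rank at
most `2`. -/
theorem stmt6 {k : Type*} [Field k] (h2 : (2 : k) ≠ 0) {n : ℕ} (hn : 0 < n)
    (Cm : Matrix (Fin n) (Fin n) k) (hCm : Cmᵀ = -Cm) :
    (∃ B : PoissonBracket k (MvPolynomial (Fin n) k),
      ∀ i j : Fin n, B.br (X i) (X j)
        = MvPolynomial.C (Cm i j) * ∑ s : Fin n, (X s) ^ 2) ↔
    Cm.rank ≤ 2 := by
  constructor
  · rintro ⟨B, hB⟩
    obtain ⟨c, u, v, h⟩ := exists_eq_of_plucker hCm (plucker_of_poissonBracket h2 hCm B hB)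
    exact rank_le_two_of_eq h
  · intro hr
    obtain ⟨c, u, v, h⟩ := exists_eq_of_plucker hCm (plucker_of_rank_le_two h2 hCm hr)
    refine ⟨.ofCommute _ _ (C c * ∑ s, (X s) ^ 2) (mkDerivation_C_commute u v), fun i j => ?_⟩
    simp only [PoissonBracket.ofCommute, LinearMap.mk₂_apply, mkDerivation_X, h, C_mul, C_sub]
    ring
end

section
/- Let k be an algebraically closed field of characteristic different from 2 and let C, D ∈ M_n(k) be skew-symmetric matrices (Cᵀ = −C, Dᵀ = −D). Then the following are equivalent: (1) there exist an invertible M ∈ M_n(k) and λ ∈ k, λ ≠ 0, with Mᵀ·M = λ·I and M·D·Mᵀ = λ·C; (2) there exists N ∈ M_n(k) with Nᵀ·N = I and N·D·Nᵀ = C; (3) C and D are similar, i.e. there exists an invertible P ∈ M_n(k) with P·D·P⁻¹ = C. -/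
open Matrix

/-- A polynomial that splits divides a power of any polynomial vanishing at all of its roots. -/
theorem Polynomial.Splits.dvd_pow_card_roots {k : Type*} [Field k] {p q : Polynomial k}
    (hp : p.Splits) (hp0 : p ≠ 0) (hq : ∀ a ∈ p.roots, q.eval a = 0) :
    p ∣ q ^ p.roots.card := by
  have key : ∀ s : Multiset k, (∀ a ∈ s, q.eval a = 0) →
      (s.map fun a => Polynomial.X - Polynomial.C a).prod ∣ q ^ s.card := by
    intro s
    induction s using Multiset.induction_on with
    | empty => simp
    | cons a s ih =>
      intro h
      rw [Multiset.map_cons, Multiset.prod_cons, Multiset.card_cons, pow_succ']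
      exact mul_dvd_mul (Polynomial.dvd_iff_isRoot.2 (h a (Multiset.mem_cons_self a s)))
        (ih fun b hb => h b (Multiset.mem_cons_of_mem hb))
  have hlc : IsUnit (Polynomial.C p.leadingCoeff) :=
    Polynomial.isUnit_C.2 (Polynomial.leadingCoeff_ne_zero.2 hp0).isUnit
  conv_lhs => rw [hp.eq_prod_roots]
  exact (hlc.mul_left_dvd).2 (key _ hq)

/-- `X` has a square root modulo any polynomial not vanishing at `0`. -/
theorem Polynomial.exists_dvd_sq_sub_X {k : Type*} [Field k] [IsAlgClosed k] (h2 : (2 : k) ≠ 0)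
    (p : Polynomial k) (hp : p.eval 0 ≠ 0) : ∃ f : Polynomial k, p ∣ f ^ 2 - Polynomial.X := by
  classical
  have hp0 : p ≠ 0 := by
    rintro rfl
    simp at hp
  choose s hs using fun a : k => IsAlgClosed.exists_pow_nat_eq a (n := 2) two_pos
  let g : Polynomial k := Lagrange.interpolate p.roots.toFinset id s
  have hg : ∀ a ∈ p.roots, (g ^ 2 - Polynomial.X).eval a = 0 := by
    intro a ha
    have : g.eval a = s a := Lagrange.eval_interpolate_at_node (v := id) s
      (Set.injOn_id _) (Multiset.mem_toFinset.2 ha)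
    simp [this, hs]
  have hdvd := (IsAlgClosed.splits p).dvd_pow_card_roots hp0 hg
  have hnil : IsNilpotent (AdjoinRoot.mk p (g ^ 2 - Polynomial.X)) :=
    ⟨_, by rw [← map_pow]; exact AdjoinRoot.mk_eq_zero.2 hdvd⟩
  have hroot : IsUnit (AdjoinRoot.root p) := by
    have hcop : IsCoprime (Polynomial.X : Polynomial k) p := by
      refine (Polynomial.irreducible_X.coprime_iff_not_dvd).2 fun h => hp ?_
      rwa [Polynomial.X_dvd_iff, Polynomial.coeff_zero_eq_eval_zero] at h
    obtain ⟨a, b, hab⟩ := hcop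
    have := congrArg (AdjoinRoot.mk p) hab
    simp only [map_add, map_mul, AdjoinRoot.mk_X, AdjoinRoot.mk_self, mul_zero, add_zero,
      map_one] at this
    exact IsUnit.of_mul_eq_one_right _ this
  have hunit : IsUnit (AdjoinRoot.mk p g) := by
    have : IsUnit (AdjoinRoot.mk p g ^ 2) := by
      have := hnil.isUnit_add_left_of_commute hroot (Commute.all _ _)
      simpa using this
    exact (isUnit_pow_iff two_ne_zero).1 this
  have htwo : IsUnit (2 : AdjoinRoot p) := by
    have := (IsUnit.mk0 _ h2).map (algebraMap k (AdjoinRoot p))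
    rwa [map_ofNat] at this
  let Q : Polynomial (AdjoinRoot p) := Polynomial.X ^ 2 - Polynomial.C (AdjoinRoot.root p)
  obtain ⟨r, ⟨-, hr⟩, -⟩ := Polynomial.existsUnique_nilpotent_sub_and_aeval_eq_zero
    (P := Q) (x := AdjoinRoot.mk p g) (by simpa [Q] using hnil)
    (by simpa [Q, one_add_one_eq_two] using htwo.mul hunit)
  obtain ⟨f, rfl⟩ := AdjoinRoot.mk_surjective r
  exact ⟨f, AdjoinRoot.mk_eq_zero.1 (by simpa [Q] using hr)⟩

/-- An invertible matrix over an algebraically closed field of characteristic different from two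
has a square root that is a polynomial in the matrix. -/
theorem Matrix.exists_aeval_sq_eq {k ι : Type*} [Field k] [IsAlgClosed k] [Fintype ι]
    [DecidableEq ι] (h2 : (2 : k) ≠ 0) (S : Matrix ι ι k) (hS : IsUnit S.det) :
    ∃ f : Polynomial k, Polynomial.aeval S f ^ 2 = S := by
  have h0 : S.charpoly.eval 0 ≠ 0 := by
    intro h
    rw [← Polynomial.coeff_zero_eq_eval_zero] at h
    exact hS.ne_zero (by rw [Matrix.det_eq_sign_charpoly_coeff, h, mul_zero])
  obtain ⟨f, q, hf⟩ := Polynomial.exists_dvd_sq_sub_X h2 S.charpoly h0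
  refine ⟨f, sub_eq_zero.1 ?_⟩
  have := congrArg (Polynomial.aeval S) hf
  simpa [Matrix.aeval_self_charpoly] using this

theorem Matrix.IsSymm.aeval {k ι : Type*} [CommSemiring k] [Fintype ι] [DecidableEq ι]
    {S : Matrix ι ι k} (hS : S.IsSymm) (f : Polynomial k) : (Polynomial.aeval S f).IsSymm := by
  simp only [Matrix.IsSymm, Polynomial.aeval_eq_sum_range, Matrix.transpose_sum,
    Matrix.transpose_smul, Matrix.transpose_pow, hS.eq]

/-- Similar skew-symmetric matrices over an algebraically closed field of characteristic different
from two are orthogonally similar. -/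
theorem Matrix.exists_orthogonal_conj_of_similar {k ι : Type*} [Field k] [IsAlgClosed k]
    [Fintype ι] [DecidableEq ι] (h2 : (2 : k) ≠ 0) {C D P : Matrix ι ι k} (hC : Cᵀ = -C)
    (hD : Dᵀ = -D) (hP : IsUnit P.det) (h : P * D * P⁻¹ = C) :
    ∃ N : Matrix ι ι k, Nᵀ * N = 1 ∧ N * D * Nᵀ = C := by
  have hPD : P * D = C * P := by
    rw [← h, Matrix.nonsing_inv_mul_cancel_right _ _ hP]
  have hDP : D * Pᵀ = Pᵀ * C := by
    have := congrArg Matrix.transpose hPD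
    simpa [Matrix.transpose_mul, hC, hD] using this
  have hcomm : Commute (Pᵀ * P) D := by
    rw [Commute, SemiconjBy, mul_assoc, hPD, ← mul_assoc, ← hDP, mul_assoc]
  have hdet : IsUnit (Pᵀ * P).det := by
    rw [Matrix.det_mul, Matrix.det_transpose]
    exact hP.mul hP
  obtain ⟨f, hf⟩ := Matrix.exists_aeval_sq_eq h2 (Pᵀ * P) hdet
  have hRsymm := (Matrix.isSymm_transpose_mul_self P).aeval f
  have hRD : Commute (Polynomial.aeval (Pᵀ * P) f) D := by
    rw [Polynomial.aeval_eq_sum_range]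
    exact Commute.sum_left _ _ _ fun i _ => (hcomm.pow_left i).smul_left _
  generalize Polynomial.aeval (Pᵀ * P) f = R at hf hRsymm hRD
  have hR : IsUnit R.det := by
    rw [← hf, Matrix.det_pow] at hdet
    exact (isUnit_pow_iff two_ne_zero).1 hdet
  have horth : (P * R⁻¹)ᵀ * (P * R⁻¹) = 1 := by
    rw [Matrix.transpose_mul, Matrix.transpose_nonsing_inv, hRsymm.eq, mul_assoc,
      ← mul_assoc Pᵀ, ← hf, sq, Matrix.mul_nonsing_inv_cancel_right _ _ hR,
      Matrix.nonsing_inv_mul _ hR]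
  refine ⟨P * R⁻¹, horth, ?_⟩
  have hconj : P * R⁻¹ * D = C * (P * R⁻¹) := by
    have : R⁻¹ * D = D * R⁻¹ := by
      calc R⁻¹ * D = R⁻¹ * (D * R) * R⁻¹ := by
            rw [← mul_assoc, Matrix.mul_nonsing_inv_cancel_right _ _ hR]
        _ = D * R⁻¹ := by rw [← hRD.eq, Matrix.nonsing_inv_mul_cancel_left _ _ hR]
    rw [mul_assoc, this, ← mul_assoc, hPD, mul_assoc]
  rw [hconj, mul_assoc, mul_eq_one_comm.1 horth, mul_one]

/-- Lemma 3.3: for skew-symmetric matrices over an algebraically closed field of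
characteristic ≠ 2, the scaled orthogonal equivalence, orthogonal similarity and
similarity of `C` and `D` are all equivalent. -/
theorem stmt10 {k : Type*} [Field k] [IsAlgClosed k] (h2 : (2 : k) ≠ 0) {n : ℕ}
    (C D : Matrix (Fin n) (Fin n) k) (hC : Cᵀ = -C) (hD : Dᵀ = -D) :
    ((∃ (M : Matrix (Fin n) (Fin n) k) (lam : k), IsUnit M ∧ lam ≠ 0 ∧
        Mᵀ * M = lam • (1 : Matrix (Fin n) (Fin n) k) ∧ M * D * Mᵀ = lam • C) ↔
      (∃ N : Matrix (Fin n) (Fin n) k, Nᵀ * N = 1 ∧ N * D * Nᵀ = C)) ∧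
    ((∃ N : Matrix (Fin n) (Fin n) k, Nᵀ * N = 1 ∧ N * D * Nᵀ = C) ↔
      (∃ P : Matrix (Fin n) (Fin n) k, IsUnit P.det ∧ P * D * P⁻¹ = C)) := by
  refine ⟨⟨?_, ?_⟩, ⟨?_, ?_⟩⟩
  · rintro ⟨M, lam, -, hlam, hM, hMD⟩
    obtain ⟨z, rfl⟩ := IsAlgClosed.exists_pow_nat_eq lam (n := 2) two_pos
    have hz : z⁻¹ * (z⁻¹ * z ^ 2) = 1 := by
      have : z ≠ 0 := fun h => hlam (by simp [h])
      field_simp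
    refine ⟨z⁻¹ • M, ?_, ?_⟩
    · simp [hM, smul_smul, hz]
    · simp [hMD, smul_smul, hz]
  · rintro ⟨N, hN, hND⟩
    exact ⟨N, 1, IsUnit.of_mul_eq_one_right _ hN, one_ne_zero, by simpa using hN,
      by simpa using hND⟩
  · rintro ⟨N, hN, hND⟩
    refine ⟨N, (Matrix.isUnit_iff_isUnit_det N).1 (IsUnit.of_mul_eq_one_right _ hN), ?_⟩
    rwa [Matrix.inv_eq_left_inv hN]
  · rintro ⟨P, hP, h⟩
    exact Matrix.exists_orthogonal_conj_of_similar h2 hC hD hP h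
end

section
/- Let k be a field, C = (c_{ij}) ∈ M_n(k), and write ω = x_1² + ⋯ + x_n² in the polynomial algebra k[x_1, …, x_n]. Let {-,-} be a k-bilinear antisymmetric bracket on k[x_1, …, x_n] satisfying the Leibniz rule {rs, t} = r{s,t} + {r,t}s for all r, s, t, and such that {x_i, x_j} = c_{ij}·ω for all 1 ≤ i, j ≤ n. Then for all indices i, j, l one has {x_i, {x_j, x_l}} + {x_j, {x_l, x_i}} + {x_l, {x_i, x_j}} = 2·ω·Σ_{s=1}^n (c_{jl}c_{is} + c_{li}c_{js} + c_{ij}c_{ls})·x_s. -/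
open MvPolynomial in
/-- The Jacobiator computation in the proof of Lemma 3.2: for a bilinear antisymmetric
Leibniz bracket with `{x_i, x_j} = c_{ij}·ω`, where `ω = x_1² + ⋯ + x_n²`, one has
`{x_i,{x_j,x_l}} + {x_j,{x_l,x_i}} + {x_l,{x_i,x_j}}
  = 2ω·Σ_s (c_{jl}c_{is} + c_{li}c_{js} + c_{ij}c_{ls}) x_s`. -/
theorem stmt15 {k : Type*} [Field k] {n : ℕ} (Cm : Matrix (Fin n) (Fin n) k)
    (br : MvPolynomial (Fin n) k →ₗ[k] MvPolynomial (Fin n) k →ₗ[k] MvPolynomial (Fin n) k)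
    (hanti : ∀ u v : MvPolynomial (Fin n) k, br u v = - br v u)
    (hleib : ∀ r s t : MvPolynomial (Fin n) k, br (r * s) t = r * br s t + br r t * s)
    (hgen : ∀ i j : Fin n, br (X i) (X j)
      = MvPolynomial.C (Cm i j) * ∑ s : Fin n, (X s) ^ 2) :
    ∀ i j l : Fin n,
      br (X i) (br (X j) (X l)) + br (X j) (br (X l) (X i)) + br (X l) (br (X i) (X j))
        = 2 * (∑ s : Fin n, (X s : MvPolynomial (Fin n) k) ^ 2) *
            ∑ s : Fin n,
              MvPolynomial.C (Cm j l * Cm i s + Cm l i * Cm j s + Cm i j * Cm l s) * X s := by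
  have hright : ∀ r s t : MvPolynomial (Fin n) k, br t (r * s) = r * br t s + br t r * s := by
    intro r s t
    rw [hanti t (r * s), hleib, hanti s t, hanti r t]
    ring
  have key : ∀ (a : k) (i : Fin n),
      br (X i) (MvPolynomial.C a * ∑ s : Fin n, (X s) ^ 2)
        = 2 * (∑ s : Fin n, (X s : MvPolynomial (Fin n) k) ^ 2) *
            ∑ s : Fin n, MvPolynomial.C (a * Cm i s) * X s := by
    intro a i
    rw [MvPolynomial.C_mul', map_smul, map_sum, ← MvPolynomial.C_mul', Finset.mul_sum,
      Finset.mul_sum Finset.univ (fun s => MvPolynomial.C (a * Cm i s) * X s)]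
    refine Finset.sum_congr rfl fun s _ => ?_
    rw [pow_two (X s), hright, hgen, MvPolynomial.C_mul]
    ring
  intro i j l
  rw [hgen j l, hgen l i, hgen i j, key, key, key, ← mul_add, ← mul_add,
    ← Finset.sum_add_distrib, ← Finset.sum_add_distrib]
  congr 1
  refine Finset.sum_congr rfl fun s _ => ?_
  rw [MvPolynomial.C_add, MvPolynomial.C_add]
  ring
end
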